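/- arXiv:2310.09377 — 4 statements merged into one kernel-verified Lean document; each statement's English description precedes it below -/
import Mathlib

section
/- Let n, k ∈ ℕ with n ≥ k ≥ 2 and set T = ⌈n/3⌉ + k. Builder has a strategy in RR_∅(P_k,P_n) guaranteeing that after at most 3T + 2(k−1) rounds either a blue copy of P_n has appeared (so Builder has won) or the host graph contains T pairwise vertex-disjoint blue paths of length 2 (each on 3 vertices). -/
namespace OSR

/-- A partial red/blue colouring of the edges of the complete graph on `ℕ`:
`some true` = red, `some false` = blue, `none` = unselected. -/
abbrev Coloring := Sym2 ℕ → Option Bool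

/-- The colouring `C` contains a monochromatic path of colour `c` on `k` vertices. -/
def HasPath (C : Coloring) (c : Bool) (k : ℕ) : Prop :=
  ∃ f : Fin k → ℕ, Function.Injective f ∧
    ∀ i j : Fin k, (j : ℕ) = (i : ℕ) + 1 → C s(f i, f j) = some c

/-- A Builder strategy: given the current position, select an edge. -/
abbrev BuilderStrat := Coloring → Sym2 ℕ

/-- A Painter strategy: given the current position and the selected edge,
choose a colour (`true` = red, `false` = blue). -/
abbrev PainterStrat := Coloring → Sym2 ℕ → Bool

/-- The position after `t` rounds of play, starting from `C0`. -/
def play (C0 : Coloring) (B : BuilderStrat) (P : PainterStrat) : ℕ → Coloring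
  | 0 => C0
  | t + 1 =>
    Function.update (play C0 B P t) (B (play C0 B P t))
      (some (P (play C0 B P t) (B (play C0 B P t))))

/-- Builder plays legally: he always selects a previously unselected non-loop edge. -/
def BuilderOK (C0 : Coloring) (B : BuilderStrat) : Prop :=
  ∀ (P : PainterStrat) (t : ℕ),
    play C0 B P t (B (play C0 B P t)) = none ∧ ¬(B (play C0 B P t)).IsDiag

/-- The empty position: no edge has been coloured. -/
def emptyCol : Coloring := fun _ => none

/-- The online Ramsey game for `(P_k, P_n)` has ended: there is a red path on `k`
vertices or a blue path on `n` vertices. -/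
def Ends (k n : ℕ) (C : Coloring) : Prop := HasPath C true k ∨ HasPath C false n

/-- The online size Ramsey number `r̃(P_k, P_n)`: the least `t` such that Builder
has a strategy forcing, against every Painter, a red `P_k` or a blue `P_n`
within at most `t` rounds. -/
noncomputable def onlineRamseyPath (k n : ℕ) : ℕ :=
  sInf {t : ℕ | ∃ B : BuilderStrat, BuilderOK emptyCol B ∧
    ∀ P : PainterStrat, ∃ s ≤ t, Ends k n (play emptyCol B P s)}

/-- Painter plays legally in the game `RR_H(P_k, ⬝)`: he never colours an edge red
if that would create a red path on `k` vertices. -/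
def PainterOK (k : ℕ) (P : PainterStrat) : Prop :=
  ∀ (C : Coloring) (e : Sym2 ℕ),
    ¬HasPath C true k → HasPath (Function.update C e (some true)) true k →
      P C e = false

/-- The colour `c` is an allowed answer of Painter on the edge `e` in position `C`
of the game `RR(P_k, ⬝)`. -/
def Allowed (k : ℕ) (C : Coloring) (e : Sym2 ℕ) (c : Bool) : Prop :=
  c = true → ¬HasPath C true k → ¬HasPath (Function.update C e (some true)) true k

/-- One round in the variant where Builder may reselect an already coloured edge,
in which case it keeps its colour. -/
def stepR (C : Coloring) (e : Sym2 ℕ) (c : Bool) : Coloring :=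
  if C e = none then Function.update C e (some c) else C

/-- The position after `t` rounds, in the variant where a reselected edge keeps
its colour (and the round still counts). -/
def playR (C0 : Coloring) (B : BuilderStrat) (P : PainterStrat) : ℕ → Coloring
  | 0 => C0
  | t + 1 =>
    stepR (playR C0 B P t) (B (playR C0 B P t))
      (P (playR C0 B P t) (B (playR C0 B P t)))

/-- Builder plays legally in the reselection variant: he selects non-loop edges. -/
def BuilderOKR (C0 : Coloring) (B : BuilderStrat) : Prop :=
  ∀ (P : PainterStrat) (t : ℕ), ¬(B (playR C0 B P t)).IsDiag

/-- Consecutive members of `l` are joined by blue edges. -/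
def BlueChain (C : Coloring) (l : List ℕ) : Prop :=
  l.Chain' fun a b => C s(a, b) = some false

/-- Consecutive members of `l` are joined by red edges. -/
def RedChain (C : Coloring) (l : List ℕ) : Prop :=
  l.Chain' fun a b => C s(a, b) = some true

/-- `l` is the vertex sequence of a blue path (on at least one vertex) in `C`. -/
def IsBluePath (C : Coloring) (l : List ℕ) : Prop :=
  l ≠ [] ∧ l.Nodup ∧ BlueChain C l

/-- `l` is the vertex sequence of a red path (on at least one vertex) in `C`. -/
def IsRedPath (C : Coloring) (l : List ℕ) : Prop :=
  l ≠ [] ∧ l.Nodup ∧ RedChain C l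

/-- `x` is an end of the path with vertex sequence `l`. -/
def IsEnd (x : ℕ) (l : List ℕ) : Prop :=
  l.head? = some x ∨ l.getLast? = some x

/-- `e` joins two consecutive vertices of `l`, i.e. `e` is an edge of the path `l`. -/
def IsPathEdge (l : List ℕ) (e : Sym2 ℕ) : Prop :=
  ∃ (i : ℕ) (h : i + 1 < l.length),
    e = s(l.get ⟨i, Nat.lt_of_succ_lt h⟩, l.get ⟨i + 1, h⟩)

/-- The paths of the family `G` are pairwise vertex-disjoint. -/
def DisjFam {s : ℕ} (G : Fin s → List ℕ) : Prop :=
  ∀ i j, i ≠ j → ∀ x, x ∈ G i → x ∉ G j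

/-- `C` contains `T` pairwise vertex-disjoint blue paths of length 2
(i.e. on 3 vertices each). -/
def HasDisjointBluePaths3 (C : Coloring) (T : ℕ) : Prop :=
  ∃ G : Fin T → List ℕ,
    (∀ i, (G i).length = 3 ∧ IsBluePath C (G i)) ∧ DisjFam G

/-- `(G, u)` witnesses that `C` contains an essential `(s,d,m)`-graph:
`G` lists the `s` pairwise disjoint nonempty essential blue paths,
`u` lists the vertices of the essential red path, `u i` being an end of `G i`,
and the blue paths have `m` vertices in total. -/
def IsEssWitness (C : Coloring) (s d m : ℕ)
    (G : Fin s → List ℕ) (u : Fin d → ℕ) : Prop :=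
  (∀ i, IsBluePath C (G i)) ∧ DisjFam G ∧
  Function.Injective u ∧
  (∀ i j : Fin d, (j : ℕ) = (i : ℕ) + 1 → C s(u i, u j) = some true) ∧
  (∀ (i : Fin d) (h : (i : ℕ) < s), IsEnd (u i) (G ⟨i, h⟩)) ∧
  (∑ i, (G i).length) = m

/-- `C` contains an essential `(s,d,m)`-graph. -/
def IsEssGraph (C : Coloring) (s d m : ℕ) : Prop :=
  d ≤ s ∧ ∃ (G : Fin s → List ℕ) (u : Fin d → ℕ), IsEssWitness C s d m G u

/-- `C` contains an `(s,d,m)`-fence: a red picket `R` on `d` vertices whose last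
vertex is the first vertex of the blue picket `G 0`, further pairwise disjoint
nonempty blue pickets `G 1, …`, the blue pickets having `m` vertices in total. -/
def IsFence (C : Coloring) (s d m : ℕ) : Prop :=
  ∃ (hs : 0 < s) (R : List ℕ) (G : Fin s → List ℕ),
    R.length = d ∧ IsRedPath C R ∧
    (∀ i, IsBluePath C (G i)) ∧ DisjFam G ∧
    R.getLast? = (G ⟨0, hs⟩).head? ∧
    (∀ x ∈ R.dropLast, ∀ i, x ∉ G i) ∧
    (∑ i, (G i).length) = m

/-- There is a red path of length `len` (i.e. on `len + 1` vertices) with end `x`. -/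
def RedTailAt (C : Coloring) (x : ℕ) (len : ℕ) : Prop :=
  ∃ l : List ℕ, l.length = len + 1 ∧ l.head? = some x ∧ IsRedPath C l

/-- `l` is a blue `(1,1)`-path: a blue path such that each of its two ends is an
end of a red path of length 1. -/
def IsBlue11Path (C : Coloring) (l : List ℕ) : Prop :=
  IsBluePath C l ∧
  (∀ x, l.head? = some x → RedTailAt C x 1) ∧
  (∀ x, l.getLast? = some x → RedTailAt C x 1)

/-- `l = [u_1, …, u_k, u_{k+1}]` is an extended `(2,0)`-path: `k ≥ 2`, the edge
`u_k u_{k+1}` is red and `u_1 … u_k` is a blue `(2,0)`-path with `2`-end `u_k`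
(its blue end is `u_1`, its transition vertex `u_k`, its red end `u_{k+1}`). -/
def IsExtPath (C : Coloring) (l : List ℕ) : Prop :=
  3 ≤ l.length ∧ l.Nodup ∧ BlueChain C l.dropLast ∧
  ∀ a b, l.dropLast.getLast? = some a → l.getLast? = some b →
    C s(a, b) = some true ∧ RedTailAt C a 2

/-- The vertices `x 0, …, x 4` form a limb in `C`: blue edges `x0x1`, `x2x3`,
`x1x4` and a red edge `x1x2` (paper notation: blue `x1x2, x3x4, x2x5`, red `x2x3`). -/
def IsLimb (C : Coloring) (x : Fin 5 → ℕ) : Prop :=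
  Function.Injective x ∧
  C s(x 0, x 1) = some false ∧ C s(x 2, x 3) = some false ∧
  C s(x 1, x 4) = some false ∧ C s(x 1, x 2) = some true

/-- The four edges of the limb on `x 0, …, x 4`. -/
def limbEdgeSet (x : Fin 5 → ℕ) : Set (Sym2 ℕ) :=
  {s(x 0, x 1), s(x 2, x 3), s(x 1, x 4), s(x 1, x 2)}

/-- The limb on `x 0, …, x 4` is a component of `C`: every edge of `C` meeting
a limb vertex is an edge of the limb. -/
def LimbComponent (C : Coloring) (x : Fin 5 → ℕ) : Prop :=
  ∀ e, C e ≠ none → (∃ v ∈ e, v ∈ Set.range x) → e ∈ limbEdgeSet x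

/-- The red edges of `C` with at least one end in `S`. -/
def RedAt (C : Coloring) (S : Set ℕ) : Set (Sym2 ℕ) :=
  {e | C e = some true ∧ ∃ v ∈ e, v ∈ S}

/-- The blue edges of `C` with at least one end in `S`. -/
def BlueAt (C : Coloring) (S : Set ℕ) : Set (Sym2 ℕ) :=
  {e | C e = some false ∧ ∃ v ∈ e, v ∈ S}

def redEdges (C : Coloring) : Set (Sym2 ℕ) := {e | C e = some true}

def blueEdges (C : Coloring) : Set (Sym2 ℕ) := {e | C e = some false}

def allEdges (C : Coloring) : Set (Sym2 ℕ) := {e | C e ≠ none}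

/-- The vertices of the coloured graph `C` (ends of coloured edges). -/
def supp (C : Coloring) : Set ℕ := {v | ∃ e, C e ≠ none ∧ v ∈ e}

/-- `a` and `b` are adjacent in `C`. -/
def Adj (C : Coloring) (a b : ℕ) : Prop := a ≠ b ∧ C s(a, b) ≠ none

/-- `G_0 ∪ Red_H(G_0)` is a component of the coloured graph: every blue edge
meeting the blue path `l` is an edge of `l`, and the other end `y` of any red
edge leaving `l` meets only red edges coming back to `l`. -/
def G0Component (C : Coloring) (l : List ℕ) : Prop :=
  (∀ e, C e = some false → (∃ v ∈ e, v ∈ l) → IsPathEdge l e) ∧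
  (∀ x ∈ l, ∀ y : ℕ, C s(x, y) = some true → y ∉ l →
    ∀ e, C e ≠ none → y ∈ e → C e = some true ∧ ∃ v ∈ e, v ∈ l)

/-- The underlying list of an optional path (`∅` has no vertices). -/
def listOf (o : Option (List ℕ)) : List ℕ := o.getD []

/-- The vertex set of an optional limb. -/
def limbVertsOf : Option (Fin 5 → ℕ) → Set ℕ
  | none => ∅
  | some x => Set.range x

/-- The data of the four (possibly empty) essential subgraphs `(G_0, G_1, G_2, L)`
of a good graph: `G0` is a blue path, `G1` a blue `(1,1)`-path, `G2` an extended
`(2,0)`-path (each given by its vertex sequence), and `L` a limb. -/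
structure GoodData where
  G0 : Option (List ℕ)
  G1 : Option (List ℕ)
  G2 : Option (List ℕ)
  L : Option (Fin 5 → ℕ)

def GoodData.vG0 (D : GoodData) : ℕ := (listOf D.G0).length
def GoodData.vG1 (D : GoodData) : ℕ := (listOf D.G1).length
def GoodData.vG2 (D : GoodData) : ℕ := (listOf D.G2).length
def GoodData.vL (D : GoodData) : ℕ := match D.L with | none => 0 | some _ => 5

/-- The number of essential vertices. -/
def GoodData.ess (D : GoodData) : ℕ := D.vG0 + D.vG1 + D.vG2 + D.vL

/-- The set of essential vertices. -/
def GoodData.verts (D : GoodData) : Set ℕ :=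
  {v | v ∈ listOf D.G0} ∪ {v | v ∈ listOf D.G1} ∪ {v | v ∈ listOf D.G2} ∪
    limbVertsOf D.L

/-- The essential subgraphs are pairwise vertex-disjoint. -/
def GoodData.PartsDisjoint (D : GoodData) : Prop :=
  (∀ x ∈ listOf D.G0, x ∉ listOf D.G1) ∧
  (∀ x ∈ listOf D.G0, x ∉ listOf D.G2) ∧
  (∀ x ∈ listOf D.G0, x ∉ limbVertsOf D.L) ∧
  (∀ x ∈ listOf D.G1, x ∉ listOf D.G2) ∧
  (∀ x ∈ listOf D.G1, x ∉ limbVertsOf D.L) ∧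
  (∀ x ∈ listOf D.G2, x ∉ limbVertsOf D.L)

/-- At least three of the four essential subgraphs are empty. -/
def GoodData.Simple (D : GoodData) : Prop :=
  (D.G0 = none ∧ D.G1 = none ∧ D.G2 = none) ∨
  (D.G0 = none ∧ D.G1 = none ∧ D.L = none) ∨
  (D.G0 = none ∧ D.G2 = none ∧ D.L = none) ∨
  (D.G1 = none ∧ D.G2 = none ∧ D.L = none)

/-- `C` is a good graph with essential subgraphs `D = (G_0, G_1, G_2, L)`:
conditions (A)–(F) of the paper, where `⌈2x/5⌉ = (2x+4)/5` in `ℕ`. -/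
def IsGood (C : Coloring) (D : GoodData) : Prop :=
  -- `C` is a (finite) coloured graph
  (allEdges C).Finite ∧
  (∀ e, C e ≠ none → ¬e.IsDiag) ∧
  -- the essential subgraphs are pairwise vertex-disjoint
  D.PartsDisjoint ∧
  -- (A): `L = ∅` or `L` is a limb and a component of `C`
  (∀ x, D.L = some x → IsLimb C x ∧ LimbComponent C x) ∧
  -- (B): `G0 = ∅` or `G0` is a blue path, `G0 ∪ Red_H(G0)` is a component,
  -- and `|Red_H(G0)| ≤ ⌈2 v(G0)/5⌉ - 1`
  (∀ l, D.G0 = some l → IsBluePath C l ∧ G0Component C l ∧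
    (RedAt C {v | v ∈ l}).ncard + 1 ≤ (2 * l.length + 4) / 5) ∧
  -- (C): `G2 = ∅` or `G2` is an extended (2,0)-path on ≥ 3 vertices
  (∀ l, D.G2 = some l → IsExtPath C l) ∧
  -- (C): `G1 = ∅` or `G1` is a blue (1,1)-path whose 1-ends are not adjacent
  -- to the blue end, the red end or the transition vertex of `G2`
  (∀ l, D.G1 = some l → IsBlue11Path C l ∧
    ∀ l2, D.G2 = some l2 → ∀ a, IsEnd a l → ∀ b : ℕ,
      (l2.head? = some b ∨ l2.getLast? = some b ∨ l2.dropLast.getLast? = some b) →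
      ¬Adj C a b) ∧
  -- (C): `Blue_H(G1 ∪ G2) \ E(G1 ∪ G2) = ∅`
  (∀ e, C e = some false → (∃ v ∈ e, v ∈ listOf D.G1 ∨ v ∈ listOf D.G2) →
    IsPathEdge (listOf D.G1) e ∨ IsPathEdge (listOf D.G2) e) ∧
  -- (C): `|Red_H(G1 ∪ G2)| ≤ ⌈2 v(G1 ∪ G2)/5⌉`
  (RedAt C {v | v ∈ listOf D.G1 ∨ v ∈ listOf D.G2}).ncard ≤
    (2 * (D.vG1 + D.vG2) + 4) / 5 ∧
  -- (D), (E): every edge of `C` has an end among the essential vertices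
  (∀ e, C e ≠ none → ∃ v ∈ e, v ∈ D.verts) ∧
  -- (F)
  (5 ∣ D.vG0 ∨ 5 ∣ D.vG1 + D.vG2)

/-- `C` is a very good graph with essential subgraphs `D`: condition (G). -/
def IsVeryGood (C : Coloring) (D : GoodData) : Prop :=
  IsGood C D ∧ 5 ∣ D.vG0 ∧ 5 ∣ D.vG1 + D.vG2

open Classical in
/-- Delete from `C` the vertices of `S` together with all incident edges. -/
noncomputable def deleteVerts (C : Coloring) (S : Set ℕ) : Coloring :=
  fun e => if ∃ v ∈ e, v ∈ S then none else C e

/-- The union of two (edge-disjoint) coloured graphs. -/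
def unionCol (C C' : Coloring) : Coloring :=
  fun e => match C e with
    | some c => some c
    | none => C' e

end OSR

namespace OSR

theorem allEdges_update {C : Coloring} (e : Sym2 ℕ) (c : Bool) :
    allEdges (Function.update C e (some c)) = insert e (allEdges C) := by
  ext f
  by_cases h : f = e <;> simp [allEdges, h]

/-- Colouring an uncoloured edge destroys no coloured edge. -/
theorem update_eq_some {C : Coloring} {e f : Sym2 ℕ} {c c' : Bool} (he : C e = none)
    (hf : C f = some c') : Function.update C e (some c) f = some c' := by
  rw [Function.update_of_ne, hf]
  rintro rfl
  simp [he] at hf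

/-- A memoryless record of Builder's progress. `W` lists disjoint blue paths on three vertices,
`S` is a nonempty stack whose first components form a red path; each of them is joined in blue to
the at most one vertex in its second component. All vertices in use are below `N`, and the
number of coloured edges is bounded in terms of `W` and `S`. -/
structure Progress (C : Coloring) (W : List (List ℕ)) (S : List (ℕ × List ℕ)) (N : ℕ) : Prop where
  ne_nil : S ≠ []
  nodup : (W.flatten ++ S.flatMap fun a => a.1 :: a.2).Nodup
  lt_of_mem : ∀ x ∈ W.flatten ++ S.flatMap fun a => a.1 :: a.2, x < N
  lt_of_edge : ∀ e, C e ≠ none → ∀ v ∈ e, v < N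
  length_eq : ∀ w ∈ W, w.length = 3
  blue : ∀ w ∈ W, BlueChain C w
  red : RedChain C (S.map Prod.fst)
  pendant : ∀ a ∈ S, ∀ y ∈ a.2, C s(a.1, y) = some false
  pendant_length : ∀ a ∈ S, a.2.length ≤ 1
  finite : (allEdges C).Finite
  card_le : (allEdges C).ncard ≤ 3 * W.length + (S.map fun a => a.2.length + 1).sum

theorem progress_emptyCol : Progress emptyCol [] [(0, [])] 1 where
  ne_nil := by simp
  nodup := by simp
  lt_of_mem := by simp
  lt_of_edge := by simp [emptyCol]
  length_eq := by simp
  blue := by simp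
  red := List.isChain_singleton _
  pendant := by simp
  pendant_length := by simp
  finite := by simp [allEdges, emptyCol]
  card_le := by simp [allEdges, emptyCol]

/-- A position in which some `Progress` record exists. -/
def InProgress (C : Coloring) : Prop := ∃ W S N, Progress C W S N

theorem BlueChain.update {C : Coloring} {e : Sym2 ℕ} {c : Bool} {l : List ℕ} (he : C e = none)
    (h : BlueChain C l) : BlueChain (Function.update C e (some c)) l :=
  List.IsChain.imp (fun _ _ hab => update_eq_some he hab) h

theorem RedChain.update {C : Coloring} {e : Sym2 ℕ} {c : Bool} {l : List ℕ} (he : C e = none)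
    (h : RedChain C l) : RedChain (Function.update C e (some c)) l :=
  List.IsChain.imp (fun _ _ hab => update_eq_some he hab) h

/-- Joining the top of the stack to a fresh vertex makes progress, whatever Painter answers. -/
theorem InProgress.exists_edge {C : Coloring} (h : InProgress C) :
    ∃ e : Sym2 ℕ, ¬e.IsDiag ∧ C e = none ∧
      ∀ c, InProgress (Function.update C e (some c)) := by
  obtain ⟨W, S, N, h⟩ := h
  obtain ⟨⟨u, b⟩, S, rfl⟩ := List.exists_cons_of_ne_nil h.ne_nil
  have huN : u < N := h.lt_of_mem u (by simp)
  have he : C s(u, N) = none := by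
    by_contra hne
    exact absurd (h.lt_of_edge _ hne N (by simp)) (lt_irrefl N)
  have hcard (c : Bool) : (allEdges (Function.update C s(u, N) (some c))).ncard
      = (allEdges C).ncard + 1 := by
    rw [allEdges_update, Set.ncard_insert_of_notMem (by simp [allEdges, he]) h.finite]
  have hfin (c : Bool) : (allEdges (Function.update C s(u, N) (some c))).Finite := by
    rw [allEdges_update]
    exact h.finite.insert _
  have hedge (c : Bool) : ∀ e, Function.update C s(u, N) (some c) e ≠ none →
      ∀ v ∈ e, v < N + 1 := by
    intro e hne v hv
    by_cases heq : e = s(u, N)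
    · subst heq
      rcases Sym2.mem_iff.1 hv with rfl | rfl <;> omega
    · rw [Function.update_of_ne heq] at hne
      exact (h.lt_of_edge e hne v hv).trans (Nat.lt_succ_self N)
  have hN : Function.update C s(u, N) (some false) s(u, N) = some false := by simp
  have hnd := h.nodup
  have hlt := h.lt_of_mem
  have hnN : N ∉ W.flatten ++ ((u, b) :: S).flatMap fun a => a.1 :: a.2 :=
    fun hm => lt_irrefl N (hlt N hm)
  have hpl := h.pendant_length
  have hp := h.pendant
  have hc := h.card_le
  refine ⟨s(u, N), by simpa using huN.ne, he, fun c => ?_⟩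
  cases c with
  | true =>
    refine ⟨W, (N, []) :: (u, b) :: S, N + 1, by simp, ?_, ?_, hedge _, h.length_eq,
      fun w hw => (h.blue w hw).update he, ?_, ?_, ?_, hfin _, ?_⟩
    · refine (List.perm_middle (a := N) |>.nodup_iff).2 (List.nodup_cons.2 ⟨hnN, hnd⟩)
    · intro x hx
      rcases List.mem_cons.1 ((List.perm_middle (a := N)).mem_iff.1 hx) with rfl | hx
      · omega
      · exact (hlt x hx).trans (Nat.lt_succ_self N)
    · refine List.isChain_cons_cons.2 ⟨?_, RedChain.update he h.red⟩
      rw [Sym2.eq_swap]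
      simp
    · intro a ha y hy
      rcases List.mem_cons.1 ha with rfl | ha
      · simp at hy
      · exact update_eq_some he (hp a ha y hy)
    · intro a ha
      rcases List.mem_cons.1 ha with rfl | ha
      · simp
      · exact hpl a ha
    · rw [hcard]
      simp only [List.map_cons, List.sum_cons, List.length_nil] at hc ⊢
      omega
  | false =>
    have hb := hpl _ List.mem_cons_self
    rcases b with - | ⟨y, - | ⟨z, b⟩⟩
    · refine ⟨W, (u, [N]) :: S, N + 1, by simp, ?_, ?_, hedge _, h.length_eq,
        fun w hw => (h.blue w hw).update he, h.red.update he, ?_, ?_, hfin _, ?_⟩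
      · simp only [List.nodup_append, List.flatMap_cons] at hnd hnN ⊢
        grind
      · intro x hx
        have : x = N ∨ x ∈ W.flatten ++ ((u, []) :: S).flatMap fun a => a.1 :: a.2 := by
          simp only [List.flatMap_cons] at hx ⊢
          grind
        rcases this with rfl | hx
        · omega
        · exact (hlt x hx).trans (Nat.lt_succ_self N)
      · intro a ha y hy
        rcases List.mem_cons.1 ha with rfl | ha
        · rw [List.mem_singleton.1 hy, hN]
        · exact update_eq_some he (hp a (List.mem_cons_of_mem _ ha) y hy)
      · intro a ha
        rcases List.mem_cons.1 ha with rfl | ha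
        · simp
        · exact hpl a (List.mem_cons_of_mem _ ha)
      · rw [hcard]
        simp only [List.map_cons, List.sum_cons, List.length_nil, List.length_cons] at hc ⊢
        omega
    · have hlen : ∀ w ∈ [y, u, N] :: W, w.length = 3 := by
        intro w hw
        rcases List.mem_cons.1 hw with rfl | hw
        · rfl
        · exact h.length_eq w hw
      have hblue : ∀ w ∈ [y, u, N] :: W,
          BlueChain (Function.update C s(u, N) (some false)) w := by
        intro w hw
        rcases List.mem_cons.1 hw with rfl | hw
        · refine List.isChain_cons_cons.2 ⟨update_eq_some he ?_, List.isChain_pair.2 hN⟩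
          rw [Sym2.eq_swap]
          exact hp _ List.mem_cons_self y (by simp)
        · exact (h.blue w hw).update he
      have hnd' : (([y, u, N] :: W).flatten ++ S.flatMap fun a => a.1 :: a.2).Nodup := by
        simp only [List.nodup_append, List.flatMap_cons, List.flatten_cons] at hnd hnN ⊢
        grind
      have hlt' : ∀ x ∈ ([y, u, N] :: W).flatten ++ S.flatMap fun a => a.1 :: a.2,
          x < N + 1 := by
        intro x hx
        have : x = N ∨ x ∈ W.flatten ++ ((u, [y]) :: S).flatMap fun a => a.1 :: a.2 := by
          simp only [List.flatMap_cons, List.flatten_cons] at hx ⊢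
          grind
        rcases this with rfl | hx
        · omega
        · exact (hlt x hx).trans (Nat.lt_succ_self N)
      rcases S.eq_nil_or_concat with rfl | hS
      · refine ⟨[y, u, N] :: W, [(N + 1, [])], N + 2, by simp, ?_, ?_, ?_, hlen, hblue,
          List.isChain_singleton _, by simp, by simp, hfin _, ?_⟩
        · simp only [List.flatMap_nil, List.append_nil] at hnd' hlt'
          refine List.nodup_append.2 ⟨hnd', by simp, ?_⟩
          intro a ha b hb
          have := hlt' a ha
          simp only [List.flatMap_cons, List.flatMap_nil, List.append_nil,
            List.mem_singleton] at hb
          omega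
        · intro x hx
          rcases List.mem_append.1 hx with hx | hx
          · have := hlt' x (List.mem_append_left _ hx)
            omega
          · simp only [List.flatMap_cons, List.flatMap_nil, List.append_nil,
              List.mem_singleton] at hx
            omega
        · intro e hne v hv
          have := hedge _ e hne v hv
          omega
        · rw [hcard]
          simp only [List.map_cons, List.map_nil, List.sum_cons, List.sum_nil, List.length_nil,
            List.length_cons] at hc ⊢
          omega
      · refine ⟨[y, u, N] :: W, S, N + 1, by obtain ⟨_, _, rfl⟩ := hS; simp, hnd', hlt',
          hedge _, hlen, hblue, RedChain.update he (List.IsChain.tail h.red),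
          fun a ha y hy => update_eq_some he (hp a (List.mem_cons_of_mem _ ha) y hy),
          fun a ha => hpl a (List.mem_cons_of_mem _ ha), hfin _, ?_⟩
        rw [hcard]
        simp only [List.map_cons, List.sum_cons, List.length_nil, List.length_cons] at hc ⊢
        omega
    · simp at hb

theorem HasPath.mono {C : Coloring} {c : Bool} {k d : ℕ} (hkd : k ≤ d) (h : HasPath C c d) :
    HasPath C c k := by
  obtain ⟨f, hf, hC⟩ := h
  exact ⟨f ∘ Fin.castLE hkd, hf.comp (Fin.castLE_injective hkd),
    fun i j hij => hC _ _ (by simpa using hij)⟩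

theorem RedChain.hasPath {C : Coloring} {l : List ℕ} (h : RedChain C l) (hl : l.Nodup) :
    HasPath C true l.length := by
  refine ⟨l.get, List.nodup_iff_injective_get.1 hl, ?_⟩
  rintro ⟨i, hi⟩ ⟨j, hj⟩ hij
  obtain rfl : j = i + 1 := hij
  exact List.isChain_iff_getElem.1 h i hj

theorem Progress.hasDisjointBluePaths3 {C : Coloring} {W : List (List ℕ)}
    {S : List (ℕ × List ℕ)} {N T : ℕ} (h : Progress C W S N) (hT : T ≤ W.length) :
    HasDisjointBluePaths3 C T := by
  obtain ⟨hW, hdisj⟩ := List.nodup_flatten.1 (List.nodup_append.1 h.nodup).1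
  refine ⟨fun i => W.get (Fin.castLE hT i), fun i => ?_, fun i j hij x hi hj => ?_⟩
  · have hmem := W.get_mem (Fin.castLE hT i)
    have hlen := h.length_eq _ hmem
    exact ⟨hlen, List.ne_nil_of_length_pos (hlen ▸ Nat.succ_pos 2), hW _ hmem, h.blue _ hmem⟩
  · rcases lt_or_gt_of_ne hij with hlt | hlt
    · exact List.pairwise_iff_get.1 hdisj (Fin.castLE hT i) (Fin.castLE hT j) hlt hi hj
    · exact List.pairwise_iff_get.1 hdisj (Fin.castLE hT j) (Fin.castLE hT i) hlt hj hi

theorem Progress.length_stack_lt {C : Coloring} {W : List (List ℕ)} {S : List (ℕ × List ℕ)}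
    {N k : ℕ} (h : Progress C W S N) (hk : ¬HasPath C true k) : S.length < k := by
  by_contra! hle
  refine hk (HasPath.mono (by simpa using hle) (h.red.hasPath ?_))
  have hS := (List.nodup_append.1 h.nodup).2.1
  refine hS.sublist ?_
  clear * -
  induction S with
  | nil => simp
  | cons a S ih =>
    simp only [List.map_cons, List.flatMap_cons, List.cons_append]
    exact (ih.trans (List.sublist_append_right _ _)).cons_cons _

theorem Progress.ncard_le {C : Coloring} {W : List (List ℕ)} {S : List (ℕ × List ℕ)}
    {N : ℕ} (h : Progress C W S N) : (allEdges C).ncard ≤ 3 * W.length + 2 * S.length := by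
  refine h.card_le.trans ?_
  have := List.sum_le_card_nsmul (S.map fun a => a.2.length + 1) 2 (by
    intro m hm
    obtain ⟨a, ha, rfl⟩ := List.mem_map.1 hm
    have := h.pendant_length a ha
    omega)
  simp only [List.length_map, smul_eq_mul] at this
  omega

theorem not_hasPath_emptyCol {c : Bool} {k : ℕ} (hk : 2 ≤ k) : ¬HasPath emptyCol c k := by
  rintro ⟨f, -, hf⟩
  simpa [emptyCol] using hf ⟨0, by omega⟩ ⟨1, by omega⟩ rfl

theorem PainterOK.not_hasPath_update {k : ℕ} {P : PainterStrat} (hP : PainterOK k P)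
    {C : Coloring} (e : Sym2 ℕ) (h : ¬HasPath C true k) :
    ¬HasPath (Function.update C e (some (P C e))) true k := by
  intro hpath
  cases hc : P C e with
  | true =>
    rw [hc] at hpath
    simp [hP C e h hpath] at hc
  | false =>
    obtain ⟨f, hf, hC⟩ := hpath
    refine h ⟨f, hf, fun i j hij => ?_⟩
    have := hC i j hij
    rw [hc] at this
    by_cases heq : s(f i, f j) = e
    · simp [heq] at this
    · rwa [Function.update_of_ne heq] at this

open Classical in
/-- Builder selects an edge that makes progress whenever there is one. -/
noncomputable def progressStrat : BuilderStrat := fun C =>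
  if h : InProgress C then h.exists_edge.choose else s(0, 1)

theorem builderOKR_progressStrat (C0 : Coloring) : BuilderOKR C0 progressStrat := by
  intro P t
  generalize playR C0 progressStrat P t = C
  unfold progressStrat
  split_ifs with h
  · exact h.exists_edge.choose_spec.1
  · simp

theorem playR_progressStrat {k : ℕ} (hk : 2 ≤ k) {P : PainterStrat} (hP : PainterOK k P)
    (t : ℕ) :
    InProgress (playR emptyCol progressStrat P t) ∧
      ¬HasPath (playR emptyCol progressStrat P t) true k ∧
      (allEdges (playR emptyCol progressStrat P t)).ncard = t := by
  induction t with
  | zero =>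
    exact ⟨⟨_, _, _, progress_emptyCol⟩, not_hasPath_emptyCol hk,
      by simp [playR, allEdges, emptyCol]⟩
  | succ t ih =>
    rw [playR]
    generalize playR emptyCol progressStrat P t = C at ih
    obtain ⟨hC, hred, hcard⟩ := ih
    have hB : progressStrat C = hC.exists_edge.choose := dif_pos hC
    obtain ⟨-, hnone, hnext⟩ := hC.exists_edge.choose_spec
    rw [← hB] at hnone hnext
    rw [stepR, if_pos hnone]
    refine ⟨hnext _, hP.not_hasPath_update _ hred, ?_⟩
    obtain ⟨W, S, N, h⟩ := hC
    rw [allEdges_update, Set.ncard_insert_of_notMem (by simp [allEdges, hnone]) h.finite, hcard]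

end OSR

/-- **Lemma 1.** Let `n ≥ k ≥ 2` and `T = ⌈n/3⌉ + k`. Builder has a strategy in
`RR_∅(P_k, P_n)` such that after at most `3T + 2(k−1)` rounds either a blue `P_n`
has appeared or the host graph contains `T` vertex-disjoint blue paths of length 2. -/
theorem OSR.shortpaths (n k : ℕ) (hk : 2 ≤ k) (hkn : k ≤ n) :
    ∃ B : OSR.BuilderStrat, OSR.BuilderOKR OSR.emptyCol B ∧
      ∀ P : OSR.PainterStrat, OSR.PainterOK k P →
        ∃ s ≤ 3 * ((n + 2) / 3 + k) + 2 * (k - 1),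
          OSR.HasPath (OSR.playR OSR.emptyCol B P s) false n ∨
            OSR.HasDisjointBluePaths3 (OSR.playR OSR.emptyCol B P s)
              ((n + 2) / 3 + k) := by
  refine ⟨progressStrat, builderOKR_progressStrat _, fun P hP => ⟨_, le_rfl, Or.inr ?_⟩⟩
  obtain ⟨⟨W, S, N, h⟩, hred, hcard⟩ :=
    playR_progressStrat hk hP (3 * ((n + 2) / 3 + k) + 2 * (k - 1))
  have hle := h.ncard_le
  have hS := h.length_stack_lt hred
  rw [hcard] at hle
  exact h.hasDisjointBluePaths3 (by omega)
end

section
/- Let n ≥ k ≥ 2, let m, s ≥ 2 and d ≥ 1, and suppose that at some point of a game RR_H(P_k,P_n) the host graph contains an (s,d,m)-fence. Then Builder can play so that after two further rounds either a blue copy of P_n has appeared (so Builder has won) or the host graph contains an (s',d',m')-fence such that m' ≥ m − 1 and either d' ≥ d + 1 and s' ≤ s, or s' ≤ s − 1 and d' ≥ d − 1. -/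
namespace OSR

/-- The data of a fence in list form: the red picket is `P ++ [a]`, the blue pickets are
`a :: A` and the members of `L`. -/
structure ListFence (C : Coloring) (P : List ℕ) (a : ℕ) (A : List ℕ) (L : List (List ℕ)) :
    Prop where
  red : RedChain C (P ++ [a])
  blue : BlueChain C (a :: A)
  blue_rest : ∀ l ∈ L, l ≠ [] ∧ BlueChain C l
  nodup : (P ++ (a :: A ++ L.flatten)).Nodup

theorem ListFence.isFence {C : Coloring} {P : List ℕ} {a : ℕ} {A : List ℕ} {L : List (List ℕ)}
    (h : ListFence C P a A L) :
    IsFence C (L.length + 1) (P.length + 1) (a :: A ++ L.flatten).length := by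
  have hnd : (P ++ ((a :: A) :: L).flatten).Nodup := h.nodup
  rw [List.nodup_append', List.nodup_flatten] at hnd
  obtain ⟨hP, ⟨hnodup, hpair⟩, hdisj⟩ := hnd
  refine ⟨Nat.succ_pos _, P ++ [a], ((a :: A) :: L).get, by simp, ⟨by simp, ?_, h.red⟩,
    fun i => ⟨?_, hnodup _ (List.get_mem _ _), ?_⟩, ?_, by simp, ?_, ?_⟩
  · refine hP.append (by simp) ?_
    intro x hx hxa
    rw [List.mem_singleton] at hxa
    subst hxa
    exact hdisj hx (by simp)
  · refine Fin.cases (by simp) (fun j => ?_) i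
    exact (h.blue_rest _ (List.get_mem L j)).1
  · refine Fin.cases h.blue (fun j => ?_) i
    exact (h.blue_rest _ (List.get_mem L j)).2
  · intro i j hij x hxi hxj
    rw [List.pairwise_iff_get] at hpair
    rcases lt_or_gt_of_ne hij with hlt | hlt
    · exact hpair i j hlt hxi hxj
    · exact hpair j i hlt hxj hxi
  · intro x hx i hxi
    rw [List.dropLast_concat] at hx
    exact hdisj hx (List.mem_flatten.2 ⟨_, List.get_mem _ _, hxi⟩)
  · rw [← List.sum_ofFn]
    have hmap : (List.ofFn fun i => (((a :: A) :: L).get i).length) =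
        ((a :: A) :: L).map List.length := by
      conv_rhs => rw [← List.ofFn_get ((a :: A) :: L), List.map_ofFn]
      rfl
    refine (congrArg List.sum hmap).trans ?_
    simp [List.length_flatten, add_right_comm]

theorem IsFence.exists_listFence {C : Coloring} {s d m : ℕ} (h : IsFence C s d m) :
    ∃ P a A L, ListFence C P a A L ∧ L.length + 1 = s ∧ P.length + 1 = d ∧
      (a :: A ++ L.flatten).length = m := by
  obtain ⟨hs, R, G, hRd, ⟨hR0, hRn, hRc⟩, hG, hdisj, hlast, hout, hsum⟩ := h
  obtain ⟨s, rfl⟩ : ∃ t, s = t + 1 := ⟨s - 1, by omega⟩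
  obtain ⟨P, a, rfl⟩ : ∃ P a, R = P ++ [a] :=
    ⟨_, _, (List.dropLast_append_getLast hR0).symm⟩
  obtain ⟨A, hA⟩ : ∃ A, G 0 = a :: A := by
    have : (G 0).head? = some a := by simpa using hlast.symm
    exact ⟨_, (List.eq_cons_of_mem_head? this)⟩
  have hflat : a :: A ++ (List.ofFn fun i : Fin s => G i.succ).flatten = (List.ofFn G).flatten := by
    rw [List.ofFn_succ (f := G), hA]; rfl
  refine ⟨P, a, A, List.ofFn fun i : Fin s => G i.succ, ⟨hRc, hA ▸ (hG 0).2.2, ?_, ?_⟩,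
    by simp, by simpa using hRd, ?_⟩
  · intro l hl
    obtain ⟨i, rfl⟩ := (List.mem_ofFn' _ _).1 hl
    exact ⟨(hG _).1, (hG _).2.2⟩
  · rw [hflat, List.nodup_append', List.nodup_flatten]
    refine ⟨(List.nodup_append'.1 hRn).1, ⟨?_, ?_⟩, ?_⟩
    · intro l hl
      obtain ⟨i, rfl⟩ := (List.mem_ofFn' _ _).1 hl
      exact (hG i).2.1
    · rw [List.pairwise_ofFn]
      exact fun i j hij x hxi hxj => hdisj i j hij.ne x hxi hxj
    · intro x hxP hx
      obtain ⟨l, hl, hxl⟩ := List.mem_flatten.1 hx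
      obtain ⟨i, rfl⟩ := (List.mem_ofFn' _ _).1 hl
      exact hout x (by simpa using hxP) i hxl
  · rw [hflat, List.length_flatten, List.map_ofFn, List.sum_ofFn, ← hsum]
    rfl

theorem stepR_of_eq_some {C : Coloring} {e f : Sym2 ℕ} {c b : Bool} (h : C f = some b) :
    stepR C e c f = some b := by
  unfold stepR
  split_ifs with he
  · rw [Function.update_of_ne (by rintro rfl; simp [he] at h), h]
  · exact h

theorem exists_stepR_self (C : Coloring) (e : Sym2 ℕ) (c : Bool) :
    ∃ b, stepR C e c e = some b := by
  unfold stepR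
  split_ifs with he
  · exact ⟨c, by simp⟩
  · exact Option.ne_none_iff_exists'.1 he

theorem ListFence.stepR {C : Coloring} {P : List ℕ} {a : ℕ} {A : List ℕ} {L : List (List ℕ)}
    (h : ListFence C P a A L) (e : Sym2 ℕ) (c : Bool) : ListFence (stepR C e c) P a A L where
  red := List.IsChain.imp (fun _ _ => stepR_of_eq_some) h.red
  blue := List.IsChain.imp (fun _ _ => stepR_of_eq_some) h.blue
  blue_rest l hl :=
    ⟨(h.blue_rest l hl).1, List.IsChain.imp (fun _ _ => stepR_of_eq_some) (h.blue_rest l hl).2⟩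
  nodup := h.nodup

theorem BlueChain.reverse {C : Coloring} {l : List ℕ} (h : BlueChain C l) :
    BlueChain C l.reverse := by
  unfold BlueChain at *
  rw [List.Chain', List.isChain_reverse]
  exact List.IsChain.imp (fun a b hab => by rwa [Sym2.eq_swap]) h

/-- If the edge from the red picket's last vertex to the next blue picket is red, the red picket
can be extended along it. -/
theorem ListFence.extend_red {C : Coloring} {P : List ℕ} {a x : ℕ} {A B : List ℕ}
    {L : List (List ℕ)} (h : ListFence C P a A ((x :: B) :: L)) (hax : C s(a, x) = some true) :
    ∃ L', ListFence C (P ++ [a]) x B L' ∧ L'.length ≤ L.length + 1 ∧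
      L'.flatten = A ++ L.flatten := by
  have hred : RedChain C ((P ++ [a]) ++ [x]) :=
    List.IsChain.append h.red (List.isChain_singleton x) (by simpa using hax)
  have hblue : BlueChain C (x :: B) := (h.blue_rest (x :: B) (by simp)).2
  have hnd : ((P ++ [a]) ++ (x :: B ++ (A ++ L.flatten))).Nodup := by
    refine (List.Perm.nodup_iff ?_).1 h.nodup
    simp only [← Multiset.coe_eq_coe, ← Multiset.coe_add, ← Multiset.cons_coe, List.flatten_cons,
      Multiset.coe_nil, ← Multiset.singleton_add, add_zero]
    abel
  rcases A with _ | ⟨y, A⟩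
  · exact ⟨L, ⟨hred, hblue, fun l hl => h.blue_rest l (by simp [hl]), hnd⟩, by simp, rfl⟩
  · refine ⟨(y :: A) :: L, ⟨hred, hblue, ?_, hnd⟩, by simp, rfl⟩
    intro l hl
    rcases List.mem_cons.1 hl with rfl | hl
    · exact ⟨by simp, List.IsChain.tail h.blue⟩
    · exact h.blue_rest l (by simp [hl])

/-- If the edge from the red picket's last vertex to the next blue picket is blue, two blue
pickets merge into a single blue path `z :: Q`, disjoint from the shortened red picket. -/
theorem ListFence.merge_blue {C : Coloring} {P : List ℕ} {a x : ℕ} {A B : List ℕ}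
    {L : List (List ℕ)} (h : ListFence C P a A ((x :: B) :: L)) (hax : C s(a, x) = some false) :
    ∃ z Q, BlueChain C (z :: Q) ∧ (P ++ (z :: Q ++ L.flatten)).Nodup ∧
      (z :: Q).length = A.length + B.length + 2 := by
  have hblue : BlueChain C ((a :: A).reverse ++ (x :: B)) :=
    List.IsChain.append h.blue.reverse (h.blue_rest (x :: B) (by simp)).2 (by simpa using hax)
  have hnd : (P ++ (((a :: A).reverse ++ (x :: B)) ++ L.flatten)).Nodup := by
    refine (List.Perm.nodup_iff ?_).1 h.nodup
    rw [List.flatten_cons, List.append_assoc]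
    exact ((List.reverse_perm _).symm.append_right _).append_left _
  have hlen : ((a :: A).reverse ++ (x :: B)).length = A.length + B.length + 2 := by
    simp; omega
  generalize (a :: A).reverse ++ (x :: B) = l at hblue hnd hlen
  rcases l with _ | ⟨z, Q⟩
  · simp at hlen
  · exact ⟨z, Q, hblue, hnd, hlen⟩

end OSR

/-- **Lemma 4.** Let `n ≥ k ≥ 2`, `m, s ≥ 2`, `d ≥ 1`, and suppose the host graph
`C` of a game `RR(P_k, P_n)` contains an `(s,d,m)`-fence. Then Builder can play so
that after two further rounds either a blue `P_n` has appeared or the host graph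
contains an `(s',d',m')`-fence with `m' ≥ m − 1` and either `d' ≥ d + 1, s' ≤ s`,
or `s' ≤ s − 1, d' ≥ d − 1`. -/
theorem OSR.gluepk2 (n k s d m : ℕ) (hk : 2 ≤ k) (hkn : k ≤ n)
    (hm : 2 ≤ m) (hs : 2 ≤ s) (hd : 1 ≤ d)
    (C : OSR.Coloring) (hC : OSR.IsFence C s d m) :
    ∃ e1 : Sym2 ℕ, ¬e1.IsDiag ∧
      ∀ c1 : Bool, OSR.Allowed k C e1 c1 →
        ∃ e2 : Sym2 ℕ, ¬e2.IsDiag ∧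
          ∀ c2 : Bool, OSR.Allowed k (OSR.stepR C e1 c1) e2 c2 →
            OSR.HasPath (OSR.stepR (OSR.stepR C e1 c1) e2 c2) false n ∨
              ∃ s' d' m' : ℕ,
                OSR.IsFence (OSR.stepR (OSR.stepR C e1 c1) e2 c2) s' d' m' ∧
                m ≤ m' + 1 ∧
                ((d + 1 ≤ d' ∧ s' ≤ s) ∨ (s' + 1 ≤ s ∧ d ≤ d' + 1)) := by
  obtain ⟨P, a, A, L, hF, rfl, rfl, rfl⟩ := hC.exists_listFence
  obtain _ | ⟨B', L⟩ := L
  · simp at hs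
  obtain _ | ⟨x, B⟩ := B'
  · exact absurd rfl (hF.blue_rest [] (by simp)).1
  have hax : a ≠ x := by
    rintro rfl
    have := hF.nodup
    simp [List.nodup_append] at this
  refine ⟨s(a, x), by simpa using hax, fun c₁ _ => ?_⟩
  have hF₁ := hF.stepR s(a, x) c₁
  obtain ⟨b, hb⟩ := OSR.exists_stepR_self C s(a, x) c₁
  generalize OSR.stepR C s(a, x) c₁ = C₁ at hF₁ hb ⊢
  cases b with
  | true =>
    obtain ⟨L', hL', hlen, hflat⟩ := hF₁.extend_red hb
    refine ⟨s(0, 1), by simp, fun c₂ _ => Or.inr ⟨_, _, _, (hL'.stepR _ c₂).isFence, ?_, ?_⟩⟩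
    · rw [hflat]; simp; omega
    · left; simp; omega
  | false =>
    obtain ⟨z, Q, hQ, hnd, hlen⟩ := hF₁.merge_blue hb
    have hrest : ∀ l ∈ L, l ≠ [] ∧ OSR.BlueChain C₁ l :=
      fun l hl => hF₁.blue_rest l (by simp [hl])
    have hred := hF₁.red
    clear hF hF₁ hC
    simp only [List.length_cons] at hlen
    rcases List.eq_nil_or_concat P with rfl | ⟨P', w, rfl⟩
    · have hF₂ : OSR.ListFence C₁ [] z Q L := ⟨List.isChain_singleton z, hQ, hrest, hnd⟩
      refine ⟨s(0, 1), by simp, fun c₂ _ => Or.inr ⟨_, _, _, (hF₂.stepR _ c₂).isFence, ?_, ?_⟩⟩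
      · simp; omega
      · right; simp
    · rw [List.concat_eq_append] at *
      have hP' : OSR.RedChain C₁ (P' ++ [w]) := List.IsChain.left_of_append hred
      have hwz : w ≠ z := by
        rintro rfl
        simp [List.nodup_append] at hnd
      refine ⟨s(w, z), by simpa using hwz, fun c₂ _ => Or.inr ?_⟩
      have hQ₂ : OSR.BlueChain (OSR.stepR C₁ s(w, z) c₂) (z :: Q) :=
        List.IsChain.imp (fun _ _ => OSR.stepR_of_eq_some) hQ
      have hP₂ : OSR.RedChain (OSR.stepR C₁ s(w, z) c₂) (P' ++ [w]) :=
        List.IsChain.imp (fun _ _ => OSR.stepR_of_eq_some) hP'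
      have hrest₂ : ∀ l ∈ L, l ≠ [] ∧ OSR.BlueChain (OSR.stepR C₁ s(w, z) c₂) l :=
        fun l hl => ⟨(hrest l hl).1,
          List.IsChain.imp (fun _ _ => OSR.stepR_of_eq_some) (hrest l hl).2⟩
      obtain ⟨b, hb⟩ := OSR.exists_stepR_self C₁ s(w, z) c₂
      generalize OSR.stepR C₁ s(w, z) c₂ = C₂ at hQ₂ hP₂ hrest₂ hb ⊢
      cases b with
      | true =>
        have hF₂ : OSR.ListFence C₂ (P' ++ [w]) z Q L :=
          ⟨List.IsChain.append hP₂ (List.isChain_singleton z) (by simpa using hb),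
            hQ₂, hrest₂, hnd⟩
        refine ⟨_, _, _, hF₂.isFence, ?_, ?_⟩
        · simp; omega
        · right; simp
      | false =>
        have hF₂ : OSR.ListFence C₂ P' w (z :: Q) L :=
          ⟨hP₂, List.IsChain.cons_cons hb hQ₂, hrest₂, by simpa using hnd⟩
        refine ⟨_, _, _, hF₂.isFence, ?_, ?_⟩
        · simp; omega
        · right; simp
end

section
/- Let H be a good graph with essential subgraphs (G_0,G_1,G_2,L). Then the number of red edges of H is at most ⌈(2/5)·ess(H)⌉, and if G_0 ≠ ∅ it is at most ⌈(2/5)·ess(H)⌉ − 1. Moreover, if ess(H) ≥ 1, then the number of blue edges of H is at most ess(H) − 1. -/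
namespace OSR

/-- The edges of a path on the vertices `l` form a finite set of size at most `|l| - 1`. -/
theorem pathEdges_finite_ncard_le (l : List ℕ) :
    {e | IsPathEdge l e}.Finite ∧ {e | IsPathEdge l e}.ncard ≤ l.length - 1 := by
  have hsub : {e | IsPathEdge l e} ⊆
      ((Finset.range (l.length - 1)).image fun i => s(l.getD i 0, l.getD (i + 1) 0) :
        Finset (Sym2 ℕ)) := by
    rintro e ⟨i, hi, rfl⟩
    rw [Finset.mem_coe, Finset.mem_image]
    refine ⟨i, Finset.mem_range.2 (by omega), ?_⟩
    simp [hi, Nat.lt_of_succ_lt hi]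
  refine ⟨(Finset.finite_toSet _).subset hsub,
    (Set.ncard_le_ncard hsub (Finset.finite_toSet _)).trans ?_⟩
  rw [Set.ncard_coe_finset]
  simpa using Finset.card_image_le (s := Finset.range (l.length - 1))
    (f := fun i => s(l.getD i 0, l.getD (i + 1) 0))

variable {C : Coloring} {D : GoodData}

/-- A component that is a limb contains at most one red edge. -/
theorem LimbComponent.ncard_redAt_le {x : Fin 5 → ℕ} (hx : IsLimb C x)
    (hc : LimbComponent C x) : (RedAt C (Set.range x)).ncard ≤ 1 := by
  obtain ⟨-, h1, h2, h3, -⟩ := hx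
  refine (Set.ncard_le_ncard (t := {s(x 1, x 2)}) ?_ (Set.finite_singleton _)).trans
    (Set.ncard_singleton _).le
  rintro e ⟨he, hv⟩
  rcases hc e (by simp [he]) hv with rfl | rfl | rfl | rfl <;> simp_all

/-- A component that is a limb contains at most three blue edges. -/
theorem LimbComponent.ncard_blueAt_le {x : Fin 5 → ℕ} (hx : IsLimb C x)
    (hc : LimbComponent C x) : (BlueAt C (Set.range x)).ncard ≤ 3 := by
  obtain ⟨-, -, -, -, h4⟩ := hx
  refine (Set.ncard_le_ncard (t := {s(x 0, x 1), s(x 2, x 3), s(x 1, x 4)}) ?_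
    (Set.toFinite _)).trans ?_
  · rintro e ⟨he, hv⟩
    rcases hc e (by simp [he]) hv with rfl | rfl | rfl | rfl <;> simp_all
  · refine (Set.ncard_insert_le _ _).trans (Nat.succ_le_succ ?_)
    refine (Set.ncard_insert_le _ _).trans (Nat.succ_le_succ ?_)
    exact (Set.ncard_singleton _).le

theorem IsGood.ncard_redEdges_le (h : IsGood C D) :
    (redEdges C).ncard ≤ (RedAt C {v | v ∈ listOf D.G0}).ncard +
      (RedAt C {v | v ∈ listOf D.G1 ∨ v ∈ listOf D.G2}).ncard +
      (RedAt C (limbVertsOf D.L)).ncard := by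
  obtain ⟨hfin, -, -, -, -, -, -, -, -, hE, -⟩ := h
  have hred (S : Set ℕ) : (RedAt C S).Finite := hfin.subset fun e he => by
    simp [allEdges, he.1]
  have hsub : redEdges C ⊆ RedAt C {v | v ∈ listOf D.G0} ∪
      RedAt C {v | v ∈ listOf D.G1 ∨ v ∈ listOf D.G2} ∪ RedAt C (limbVertsOf D.L) := by
    intro e (he : C e = some true)
    obtain ⟨v, hve, ((hv | hv) | hv) | hv⟩ := hE e (by simp [he])
    · exact .inl (.inl ⟨he, v, hve, hv⟩)
    · exact .inl (.inr ⟨he, v, hve, .inl hv⟩)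
    · exact .inl (.inr ⟨he, v, hve, .inr hv⟩)
    · exact .inr ⟨he, v, hve, hv⟩
  refine (Set.ncard_le_ncard hsub (((hred _).union (hred _)).union (hred _))).trans ?_
  exact (Set.ncard_union_le _ _).trans (Nat.add_le_add_right (Set.ncard_union_le _ _) _)

theorem IsGood.ncard_blueEdges_le (h : IsGood C D) :
    (blueEdges C).ncard ≤ (D.vG0 - 1) + (D.vG1 - 1) + (D.vG2 - 1) +
      (BlueAt C (limbVertsOf D.L)).ncard := by
  obtain ⟨hfin, -, -, -, hB, -, -, hC, -, hE, -⟩ := h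
  have hlimb : (BlueAt C (limbVertsOf D.L)).Finite := hfin.subset fun e he => by
    simp [allEdges, he.1]
  obtain ⟨f0, n0⟩ := pathEdges_finite_ncard_le (listOf D.G0)
  obtain ⟨f1, n1⟩ := pathEdges_finite_ncard_le (listOf D.G1)
  obtain ⟨f2, n2⟩ := pathEdges_finite_ncard_le (listOf D.G2)
  have hsub : blueEdges C ⊆ {e | IsPathEdge (listOf D.G0) e} ∪
      {e | IsPathEdge (listOf D.G1) e} ∪ {e | IsPathEdge (listOf D.G2) e} ∪
      BlueAt C (limbVertsOf D.L) := by
    intro e (he : C e = some false)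
    have h12 (hv : ∃ v ∈ e, v ∈ listOf D.G1 ∨ v ∈ listOf D.G2) := hC e he hv
    obtain ⟨v, hve, ((hv | hv) | hv) | hv⟩ := hE e (by simp [he])
    · refine .inl (.inl (.inl ?_))
      cases h0 : D.G0 with
      | none => simp [h0, listOf] at hv
      | some l =>
        rw [h0] at hv
        exact (hB l h0).2.1.1 e he ⟨v, hve, hv⟩
    · exact .inl ((h12 ⟨v, hve, .inl hv⟩).imp .inr id)
    · exact .inl ((h12 ⟨v, hve, .inr hv⟩).imp .inr id)
    · exact .inr ⟨he, v, hve, hv⟩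
  refine (Set.ncard_le_ncard hsub (((f0.union f1).union f2).union hlimb)).trans ?_
  refine (Set.ncard_union_le _ _).trans (Nat.add_le_add_right ?_ _)
  refine (Set.ncard_union_le _ _).trans (Nat.add_le_add ?_ n2)
  exact (Set.ncard_union_le _ _).trans (Nat.add_le_add n0 n1)

/-- Bounds on the numbers of red and of blue edges meeting the limb of a good graph. -/
theorem IsGood.limb_bounds (h : IsGood C D) :
    5 * (RedAt C (limbVertsOf D.L)).ncard ≤ D.vL ∧
    ((BlueAt C (limbVertsOf D.L)).ncard = 0 ∧ D.vL = 0 ∨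
      (BlueAt C (limbVertsOf D.L)).ncard ≤ 3 ∧ D.vL = 5) := by
  obtain ⟨-, -, -, hA, -⟩ := h
  cases hL : D.L with
  | none => simp [limbVertsOf, RedAt, BlueAt, GoodData.vL, hL]
  | some x =>
    obtain ⟨hx, hc⟩ := hA x hL
    have hr := hc.ncard_redAt_le hx
    have hb := hc.ncard_blueAt_le hx
    have hv : D.vL = 5 := by simp [GoodData.vL, hL]
    simp only [limbVertsOf]
    exact ⟨by omega, .inr ⟨hb, hv⟩⟩

end OSR

/-- **Proposition (i).** In a good graph, the number of red edges is at most
`⌈2·ess(H)/5⌉`; if `G_0 ≠ ∅` it is at most `⌈2·ess(H)/5⌉ − 1`; and if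
`ess(H) ≥ 1`, the number of blue edges is at most `ess(H) − 1`. -/
theorem OSR.good_red_blue_count (C : OSR.Coloring) (D : OSR.GoodData)
    (h : OSR.IsGood C D) :
    (OSR.redEdges C).ncard ≤ (2 * D.ess + 4) / 5 ∧
    (D.G0 ≠ none → (OSR.redEdges C).ncard + 1 ≤ (2 * D.ess + 4) / 5) ∧
    (1 ≤ D.ess → (OSR.blueEdges C).ncard ≤ D.ess - 1) := by
  have hred := h.ncard_redEdges_le
  have hblue := h.ncard_blueEdges_le
  obtain ⟨hlr, hlb⟩ := h.limb_bounds
  obtain ⟨-, -, -, -, hB, -, -, -, h12, -, hF⟩ := h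
  have hess : D.ess = D.vG0 + D.vG1 + D.vG2 + D.vL := rfl
  have hG0 : D.G0 ≠ none →
      (OSR.RedAt C {v | v ∈ OSR.listOf D.G0}).ncard + 1 ≤ (2 * D.vG0 + 4) / 5 := by
    intro hne
    obtain ⟨l, hl⟩ := Option.ne_none_iff_exists'.1 hne
    simpa [OSR.GoodData.vG0, OSR.listOf, hl] using (hB l hl).2.2
  have hnone : D.G0 = none → (OSR.RedAt C {v | v ∈ OSR.listOf D.G0}).ncard = 0 := by
    intro h0
    simp [h0, OSR.listOf, OSR.RedAt]
  refine ⟨?_, fun hne => ?_, fun _ => ?_⟩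
  · by_cases h0 : D.G0 = none
    · have := hnone h0
      omega
    · have := hG0 h0
      omega
  · have := hG0 hne
    omega
  · omega
end

section
/- Let H be a good graph with ess(H) ≥ 1 essential vertices. Then the number of edges of H satisfies e(H) ≤ ⌈(7/5)·ess(H)⌉ − 1. -/
namespace OSR

theorem setOf_isPathEdge_eq_range (l : List ℕ) :
    {e | IsPathEdge l e} = Set.range fun i : Fin (l.length - 1) =>
      s(l.get ⟨i, by omega⟩, l.get ⟨i + 1, by omega⟩) := by
  ext e
  constructor
  · rintro ⟨i, h, rfl⟩
    exact ⟨⟨i, by omega⟩, rfl⟩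
  · rintro ⟨i, rfl⟩
    exact ⟨i, by omega, rfl⟩

theorem finite_setOf_isPathEdge (l : List ℕ) : {e | IsPathEdge l e}.Finite := by
  rw [setOf_isPathEdge_eq_range]
  exact Set.finite_range _

theorem ncard_setOf_isPathEdge_le (l : List ℕ) :
    {e | IsPathEdge l e}.ncard ≤ l.length - 1 := by
  rw [setOf_isPathEdge_eq_range, ← Set.image_univ]
  simpa using Set.ncard_image_le (f := fun i : Fin (l.length - 1) =>
    s(l.get ⟨i, by omega⟩, l.get ⟨i + 1, by omega⟩)) Set.finite_univ

theorem finite_redAt {C : Coloring} (hC : (allEdges C).Finite) (S : Set ℕ) :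
    (RedAt C S).Finite :=
  hC.subset fun e he => by simp [allEdges, he.1]

/-- The edges of an optional limb. -/
def limbEdgesOf : Option (Fin 5 → ℕ) → Set (Sym2 ℕ)
  | none => ∅
  | some x => limbEdgeSet x

theorem finite_limbEdgesOf (o : Option (Fin 5 → ℕ)) : (limbEdgesOf o).Finite := by
  cases o <;> simp [limbEdgesOf, limbEdgeSet]

theorem ncard_limbEdgeSet_le (x : Fin 5 → ℕ) : (limbEdgeSet x).ncard ≤ 4 := by
  unfold limbEdgeSet
  refine (Set.ncard_insert_le _ _).trans (Nat.succ_le_succ ?_)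
  refine (Set.ncard_insert_le _ _).trans (Nat.succ_le_succ ?_)
  refine (Set.ncard_insert_le _ _).trans (Nat.succ_le_succ ?_)
  exact (Set.ncard_singleton _).le

theorem ncard_limbEdgesOf_le (D : GoodData) : (limbEdgesOf D.L).ncard ≤ D.vL := by
  unfold GoodData.vL
  cases D.L with
  | none => simp [limbEdgesOf]
  | some x => exact (ncard_limbEdgeSet_le x).trans (by norm_num)

/-- In a good graph every edge is a red edge at `G0` or at `G1 ∪ G2`, an edge of one of
these paths, or an edge of the limb. -/
theorem IsGood.allEdges_subset {C : Coloring} {D : GoodData} (h : IsGood C D) :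
    allEdges C ⊆
      RedAt C {v | v ∈ listOf D.G0} ∪ {e | IsPathEdge (listOf D.G0) e} ∪
        (RedAt C {v | v ∈ listOf D.G1 ∨ v ∈ listOf D.G2} ∪
          ({e | IsPathEdge (listOf D.G1) e} ∪ {e | IsPathEdge (listOf D.G2) e})) ∪
        limbEdgesOf D.L := by
  obtain ⟨-, -, -, hL, h0, -, -, hblue, -, hmeet, -⟩ := h
  intro e he
  obtain ⟨v, hve, hv⟩ := hmeet e he
  obtain ⟨c, hc⟩ := Option.ne_none_iff_exists'.mp he
  rcases hv with ((hv | hv) | hv) | hv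
  · cases c with
    | true => exact .inl (.inl (.inl ⟨hc, v, hve, hv⟩))
    | false =>
      refine .inl (.inl (.inr ?_))
      cases hG : D.G0 with
      | none => simp [hG, listOf] at hv
      | some l =>
        simp only [hG, listOf, Option.getD_some, Set.mem_ofPred_eq] at hv ⊢
        exact (h0 l hG).2.1.1 e hc ⟨v, hve, hv⟩
  · cases c with
    | true => exact .inl (.inr (.inl ⟨hc, v, hve, .inl hv⟩))
    | false => exact .inl (.inr (.inr (hblue e hc ⟨v, hve, .inl hv⟩)))
  · cases c with
    | true => exact .inl (.inr (.inl ⟨hc, v, hve, .inr hv⟩))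
    | false => exact .inl (.inr (.inr (hblue e hc ⟨v, hve, .inr hv⟩)))
  · right
    cases hG : D.L with
    | none => simp [hG, limbVertsOf] at hv
    | some x =>
      rw [hG] at hv
      exact (hL x hG).2 e he ⟨v, hve, hv⟩

theorem IsGood.ncard_redAt_G0 {C : Coloring} {D : GoodData} (h : IsGood C D) :
    (RedAt C {v | v ∈ listOf D.G0}).ncard ≤ (2 * D.vG0 + 4) / 5 - 1 := by
  obtain ⟨-, -, -, -, h0, -⟩ := h
  unfold GoodData.vG0
  cases hG : D.G0 with
  | none => simp [listOf, RedAt]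
  | some l => exact Nat.le_sub_of_add_le (h0 l hG).2.2

end OSR

/-- **Proposition (ii).** A good graph with `ess(H) ≥ 1` essential vertices has at
most `⌈7·ess(H)/5⌉ − 1` edges. -/
theorem OSR.good_edge_count (C : OSR.Coloring) (D : OSR.GoodData)
    (h : OSR.IsGood C D) (hess : 1 ≤ D.ess) :
    (OSR.allEdges C).ncard + 1 ≤ (7 * D.ess + 4) / 5 := by
  have hR0 := h.ncard_redAt_G0
  have hsub := h.allEdges_subset
  obtain ⟨hfin, -, -, -, -, -, -, -, hR, -, hdvd⟩ := h
  have hle := Set.ncard_le_ncard hsub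
    ((((OSR.finite_redAt hfin _).union (OSR.finite_setOf_isPathEdge _)).union
      ((OSR.finite_redAt hfin _).union ((OSR.finite_setOf_isPathEdge _).union
        (OSR.finite_setOf_isPathEdge _)))).union (OSR.finite_limbEdgesOf _))
  have h0 : _ ≤ D.vG0 - 1 := OSR.ncard_setOf_isPathEdge_le (OSR.listOf D.G0)
  have h1 : _ ≤ D.vG1 - 1 := OSR.ncard_setOf_isPathEdge_le (OSR.listOf D.G1)
  have h2 : _ ≤ D.vG2 - 1 := OSR.ncard_setOf_isPathEdge_le (OSR.listOf D.G2)
  have hL := OSR.ncard_limbEdgesOf_le D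
  have hvL : D.vL = 0 ∨ D.vL = 5 := by
    unfold OSR.GoodData.vL
    cases D.L <;> simp
  grw [Set.ncard_union_le, Set.ncard_union_le, Set.ncard_union_le, Set.ncard_union_le,
    Set.ncard_union_le, hR0, h0, h1, h2, hL, hR] at hle
  unfold OSR.GoodData.ess at hess ⊢
  omega
end
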